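/- Let K be an algebraically closed field and let m, n be coprime integers (gcd(m,n) = 1). Let Q = {(x,y) ∈ Kˣ × Kˣ : y^m = x^n}, where powers are integer powers in the multiplicative group Kˣ. Then Q is a subgroup of Kˣ × Kˣ, and the map z ↦ (z^m, z^n) is a group isomorphism from Kˣ onto Q. -/

import Mathlib

/-- The subgroup of pairs `(x, y)` with `y ^ m = x ^ n` in the square of a commutative group. -/
def zpowEqSubgroup (G : Type*) [CommGroup G] (m n : ℤ) : Subgroup (G × G) :=
  ((zpowGroupHom m).comp (MonoidHom.snd G G)).eqLocus ((zpowGroupHom n).comp (MonoidHom.fst G G))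

theorem mem_zpowEqSubgroup {G : Type*} [CommGroup G] {m n : ℤ} {p : G × G} :
    p ∈ zpowEqSubgroup G m n ↔ p.2 ^ m = p.1 ^ n :=
  Iff.rfl

/-- A Bézout relation `a * m + b * n = 1` makes `z ↦ (z ^ m, z ^ n)` an isomorphism onto the
subgroup `y ^ m = x ^ n`, with inverse `(x, y) ↦ x ^ a * y ^ b`. -/
def zpowEqSubgroupEquiv (G : Type*) [CommGroup G] {m n a b : ℤ} (hab : a * m + b * n = 1) :
    G ≃* zpowEqSubgroup G m n where
  toFun z := ⟨(z ^ m, z ^ n), mem_zpowEqSubgroup.2 (zpow_comm z n m)⟩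
  invFun p := p.1.1 ^ a * p.1.2 ^ b
  left_inv z := by
    dsimp only
    rw [← zpow_mul, ← zpow_mul, ← zpow_add, mul_comm m, mul_comm n, hab, zpow_one]
  right_inv := by
    rintro ⟨⟨x, y⟩, hxy⟩
    replace hxy : y ^ m = x ^ n := hxy
    ext
    · change (x ^ a * y ^ b) ^ m = x
      rw [mul_zpow, zpow_comm y, hxy, ← zpow_mul, ← zpow_mul, ← zpow_add, mul_comm n, hab,
        zpow_one]
    · change (x ^ a * y ^ b) ^ n = y
      rw [mul_zpow, zpow_comm x, ← hxy, ← zpow_mul, ← zpow_mul, ← zpow_add, mul_comm m, hab,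
        zpow_one]
  map_mul' z w := Subtype.ext (Prod.ext (mul_zpow z w m) (mul_zpow z w n))

/-- for an algebraically closed field `K` and coprime integers `m, n`, the
set `Q = {(x,y) ∈ Kˣ × Kˣ : y^m = x^n}` is a subgroup of `Kˣ × Kˣ`, and `z ↦ (z^m, z^n)`
is a group isomorphism from `Kˣ` onto `Q`. -/
theorem stmt11 {K : Type*} [Field K] [IsAlgClosed K] (m n : ℤ) (h : Int.gcd m n = 1) :
    ∃ Q : Subgroup (Kˣ × Kˣ),
      (Q : Set (Kˣ × Kˣ)) = {p : Kˣ × Kˣ | p.2 ^ m = p.1 ^ n} ∧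
      ∃ e : Kˣ ≃* Q, ∀ z : Kˣ, ((e z : Kˣ × Kˣ)) = (z ^ m, z ^ n) := by
  obtain ⟨a, b, hab⟩ := Int.isCoprime_iff_gcd_eq_one.2 h
  exact ⟨zpowEqSubgroup Kˣ m n, rfl, zpowEqSubgroupEquiv Kˣ hab, fun _ => rfl⟩
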